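/- arXiv:1311.1609 — 2 statements merged into one kernel-verified Lean document; each statement's English description precedes it below -/
import Mathlib

section
/- There exist a group G, two leafless ℝ-trees T1 and T2 each of which is a simplicial metric tree all of whose edges have length 1 and each of which has at least three ends, isometric actions of G on T1 and on T2 whose induced actions on ∂∞T1 and on ∂∞T2 are two-transitive, and a G-equivariant bijection f : ∂∞T1 → ∂∞T2, such that for no real number λ > 0 does there exist a bijection f̄ : T1 → T2 with d_{T2}(f̄(x), f̄(y)) = λ·d_{T1}(x, y) for all x, y ∈ T1 that induces the map f on ∂∞T1. -/
/-- `s` is a geodesic segment joining `x` to `y`: the image of an isometric embedding of a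
compact real interval, with endpoints `x` and `y`. -/
def IsGeodesicSegmentBetween {X : Type*} [MetricSpace X] (s : Set X) (x y : X) : Prop :=
  ∃ (γ : ℝ → X) (b : ℝ), 0 ≤ b ∧
    (∀ u ∈ Set.Icc (0 : ℝ) b, ∀ v ∈ Set.Icc (0 : ℝ) b, dist (γ u) (γ v) = |u - v|) ∧
    γ 0 = x ∧ γ b = y ∧ s = γ '' Set.Icc 0 b

/-- `s` is a geodesic segment. -/
def IsGeodesicSegment {X : Type*} [MetricSpace X] (s : Set X) : Prop :=
  ∃ x y : X, IsGeodesicSegmentBetween s x y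

/-- An ℝ-tree: any two points are joined by a unique geodesic segment, and if two geodesic
segments meet exactly in a common endpoint then their union is a geodesic segment. -/
def IsRTree (X : Type*) [MetricSpace X] : Prop :=
  (∀ x y : X, ∃! s : Set X, IsGeodesicSegmentBetween s x y) ∧
  (∀ (s t : Set X) (x y z : X), IsGeodesicSegmentBetween s x y →
    IsGeodesicSegmentBetween t y z → s ∩ t = {y} → IsGeodesicSegmentBetween (s ∪ t) x z)

/-- `X` is leafless: every geodesic segment is contained in a strictly larger geodesic segment
extending it beyond each endpoint. -/
def Leafless (X : Type*) [MetricSpace X] : Prop :=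
  ∀ (x y : X) (s : Set X), IsGeodesicSegmentBetween s x y →
    ∃ (x' y' : X) (s' : Set X), IsGeodesicSegmentBetween s' x' y' ∧ s ⊆ s' ∧
      0 < dist x' x ∧ 0 < dist y y' ∧ dist x' y' = dist x' x + dist x y + dist y y'

/-- A ray: the image of an isometric embedding of `[0, ∞)`. -/
def IsRay {X : Type*} [MetricSpace X] (R : Set X) : Prop :=
  ∃ γ : ℝ → X, (∀ u ∈ Set.Ici (0 : ℝ), ∀ v ∈ Set.Ici (0 : ℝ), dist (γ u) (γ v) = |u - v|) ∧
    R = γ '' Set.Ici 0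

/-- A ray starting at the point `x`. -/
def IsRayFrom {X : Type*} [MetricSpace X] (x : X) (R : Set X) : Prop :=
  ∃ γ : ℝ → X, (∀ u ∈ Set.Ici (0 : ℝ), ∀ v ∈ Set.Ici (0 : ℝ), dist (γ u) (γ v) = |u - v|) ∧
    γ 0 = x ∧ R = γ '' Set.Ici 0

/-- An end of `X`, regarded as the set of all rays equivalent to a given ray (two rays are
equivalent when their intersection is a ray). -/
def IsEnd {X : Type*} [MetricSpace X] (e : Set (Set X)) : Prop :=
  ∃ R : Set X, IsRay R ∧ e = {R' : Set X | IsRay R' ∧ IsRay (R' ∩ R)}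

/-- The action of a map on ends (as sets of rays), by pushing every ray forward. -/
def pushEnd {X Y : Type*} (φ : X → Y) (e : Set (Set X)) : Set (Set Y) :=
  (Set.image φ) '' e

/-- Two rays starting at `x` locally coincide: their intersection contains more than `x`. -/
def LocCoincide {X : Type*} [MetricSpace X] (x : X) (R R' : Set X) : Prop :=
  ∃ p, p ∈ R ∩ R' ∧ p ≠ x

/-- `x` is a branch point: the valency of `x` (number of directions at `x`, i.e. classes of
rays from `x` up to local coincidence) is at least `3`. -/
def IsBranchPoint {X : Type*} [MetricSpace X] (x : X) : Prop :=
  ∃ R₁ R₂ R₃ : Set X, IsRayFrom x R₁ ∧ IsRayFrom x R₂ ∧ IsRayFrom x R₃ ∧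
    ¬ LocCoincide x R₁ R₂ ∧ ¬ LocCoincide x R₁ R₃ ∧ ¬ LocCoincide x R₂ R₃

/-- `X` is locally finite: every point has finite valency, i.e. finitely many directions. -/
def LocallyFiniteTree (X : Type*) [MetricSpace X] : Prop :=
  ∀ x : X, ∃ (n : ℕ) (Rs : Fin n → Set X), (∀ i, IsRayFrom x (Rs i)) ∧
    ∀ R : Set X, IsRayFrom x R → ∃ i, LocCoincide x R (Rs i)

/-- `X` admits at least three ends. -/
def AtLeastThreeEnds (X : Type*) [MetricSpace X] : Prop :=
  ∃ e₁ e₂ e₃ : Set (Set X), IsEnd e₁ ∧ IsEnd e₂ ∧ IsEnd e₃ ∧ e₁ ≠ e₂ ∧ e₁ ≠ e₃ ∧ e₂ ≠ e₃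

/-- `fbar : X → Y` induces the map `f` on ends: every ray lying in an end `e` is sent to a
ray lying in the end `f e`. -/
def Induces {X Y : Type*} [MetricSpace X] [MetricSpace Y]
    (fbar : X → Y) (f : Set (Set X) → Set (Set Y)) : Prop :=
  ∀ e : Set (Set X), IsEnd e → ∀ R ∈ e, fbar '' R ∈ f e

/-- `X` is (the geometric realization of) a simplicial metric tree all of whose edges have
length `1`: there is a vertex set with pairwise integral distances such that every point lies
on an edge, i.e. on a geodesic between two vertices at distance `1`. -/
def IsUnitSimplicialTree (X : Type*) [MetricSpace X] : Prop :=
  IsRTree X ∧ ∃ V : Set X,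
    (∀ v ∈ V, ∀ w ∈ V, ∃ n : ℕ, dist v w = (n : ℝ)) ∧
    (∀ p : X, ∃ v ∈ V, ∃ w ∈ V, dist v w = 1 ∧ dist v p + dist p w = 1)

/-- The data of a counterexample to rigidity at infinity for non-locally-finite (discrete,
unit edge length) leafless trees with a two-transitive action on the ends. -/
structure TreeRigidityCounterexample where
  T1 : Type
  T2 : Type
  [m1 : MetricSpace T1]
  [m2 : MetricSpace T2]
  G : Type
  [grp : Group G]
  ρ₁ : G →* (T1 ≃ᵢ T1)
  ρ₂ : G →* (T2 ≃ᵢ T2)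
  leafless1 : Leafless T1
  leafless2 : Leafless T2
  simp1 : IsUnitSimplicialTree T1
  simp2 : IsUnitSimplicialTree T2
  ends1 : AtLeastThreeEnds T1
  ends2 : AtLeastThreeEnds T2
  two_trans1 : ∀ a b a' b' : Set (Set T1), IsEnd a → IsEnd b → IsEnd a' → IsEnd b' →
    a ≠ b → a' ≠ b' → ∃ g : G, pushEnd (⇑(ρ₁ g)) a = a' ∧ pushEnd (⇑(ρ₁ g)) b = b'
  two_trans2 : ∀ a b a' b' : Set (Set T2), IsEnd a → IsEnd b → IsEnd a' → IsEnd b' →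
    a ≠ b → a' ≠ b' → ∃ g : G, pushEnd (⇑(ρ₂ g)) a = a' ∧ pushEnd (⇑(ρ₂ g)) b = b'
  f : Set (Set T1) → Set (Set T2)
  f_map : ∀ e, IsEnd e → IsEnd (f e)
  f_inj : ∀ e₁ e₂, IsEnd e₁ → IsEnd e₂ → f e₁ = f e₂ → e₁ = e₂
  f_surj : ∀ e', IsEnd e' → ∃ e, IsEnd e ∧ f e = e'
  f_equiv : ∀ (g : G) (e : Set (Set T1)), IsEnd e →
    f (pushEnd (⇑(ρ₁ g)) e) = pushEnd (⇑(ρ₂ g)) (f e)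
  no_extension : ∀ (lam : ℝ), 0 < lam → ∀ fbar : T1 → T2, Function.Bijective fbar →
    (∀ x y : T1, dist (fbar x) (fbar y) = lam * dist x y) → ¬ Induces fbar f


/-- The four point condition (`0`-hyperbolicity). -/
def FourPoint (X : Type*) [MetricSpace X] : Prop :=
  ∀ p q r s : X, dist p q + dist r s ≤ max (dist p r + dist q s) (dist p s + dist q r)

/-- Any two points are joined by a geodesic segment. -/
def GeodesicallyConnected (X : Type*) [MetricSpace X] : Prop :=
  ∀ x y : X, ∃ s : Set X, IsGeodesicSegmentBetween s x y

section FourPoint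

variable {X : Type*} [MetricSpace X]

theorem FourPoint.eq_of_dist_eq (hX : FourPoint X) {p q x y : X}
    (h : dist p x + dist x q = dist p q) (hp : dist p x = dist p y) (hq : dist x q = dist y q) :
    x = y := by
  have h4 := hX p q x y
  rw [dist_comm q y, dist_comm q x] at h4
  have : max (dist p x + dist y q) (dist p y + dist x q) = dist p q := by
    rw [← hp, ← hq, h, max_self]
  rw [this] at h4
  exact dist_le_zero.1 (by linarith)

theorem FourPoint.segment_eq (hX : FourPoint X) {s : Set X} {x y : X}
    (h : IsGeodesicSegmentBetween s x y) : s = {z | dist x z + dist z y = dist x y} := by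
  obtain ⟨γ, b, hb, hγ, rfl, rfl, rfl⟩ := h
  have h0 : (0 : ℝ) ∈ Set.Icc 0 b := ⟨le_rfl, hb⟩
  have h1 : b ∈ Set.Icc 0 b := ⟨hb, le_rfl⟩
  have hxy : dist (γ 0) (γ b) = b := by rw [hγ _ h0 _ h1, zero_sub, abs_neg, abs_of_nonneg hb]
  have key : ∀ u ∈ Set.Icc 0 b, dist (γ 0) (γ u) = u ∧ dist (γ u) (γ b) = b - u := by
    intro u hu
    rw [hγ _ h0 _ hu, hγ _ hu _ h1, zero_sub, abs_neg, abs_of_nonneg hu.1, abs_sub_comm,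
      abs_of_nonneg (sub_nonneg.2 hu.2)]
    exact ⟨rfl, rfl⟩
  ext z
  simp only [Set.mem_image, Set.mem_ofPred_eq]
  constructor
  · rintro ⟨u, hu, rfl⟩
    rw [(key u hu).1, (key u hu).2, hxy]; ring
  · intro hz
    have hu : dist (γ 0) z ∈ Set.Icc 0 b :=
      ⟨dist_nonneg, by linarith [dist_nonneg (x := z) (y := γ b)]⟩
    refine ⟨_, hu, (hX.eq_of_dist_eq hz (key _ hu).1.symm ?_).symm⟩
    rw [(key _ hu).2]; linarith

theorem IsGeodesicSegmentBetween.exists_mem {s : Set X} {x y : X}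
    (h : IsGeodesicSegmentBetween s x y) {a : ℝ} (ha : 0 ≤ a) (ha' : a ≤ dist x y) :
    ∃ p ∈ s, dist x p = a ∧ dist p y = dist x y - a := by
  obtain ⟨γ, b, hb, hγ, rfl, rfl, rfl⟩ := h
  have h0 : (0 : ℝ) ∈ Set.Icc 0 b := ⟨le_rfl, hb⟩
  have h1 : b ∈ Set.Icc 0 b := ⟨hb, le_rfl⟩
  have hxy : dist (γ 0) (γ b) = b := by rw [hγ _ h0 _ h1, zero_sub, abs_neg, abs_of_nonneg hb]
  rw [hxy] at ha' ⊢
  have h2 : a ∈ Set.Icc 0 b := ⟨ha, ha'⟩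
  refine ⟨γ a, ⟨a, h2, rfl⟩, ?_, ?_⟩
  · rw [hγ _ h0 _ h2, zero_sub, abs_neg, abs_of_nonneg ha]
  · rw [hγ _ h2 _ h1, abs_sub_comm, abs_of_nonneg (sub_nonneg.2 ha')]

theorem FourPoint.dist_eq_add (hX : FourPoint X) {s t : Set X} {x y z : X}
    (hs : IsGeodesicSegmentBetween s x y) (ht : IsGeodesicSegmentBetween t y z)
    (hst : s ∩ t = {y}) : dist x z = dist x y + dist y z := by
  by_contra hne
  have hlt : 0 < (dist x y + dist y z - dist x z) / 2 := by
    have := lt_of_le_of_ne (dist_triangle x y z) hne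
    linarith
  set g := (dist x y + dist y z - dist x z) / 2 with hg
  have h1 := dist_triangle x z y
  have h2 := dist_triangle y x z
  rw [dist_comm z y] at h1
  rw [dist_comm y x] at h2
  obtain ⟨p, hps, hxp, hpy⟩ := hs.exists_mem (a := dist x y - g) (by linarith) (by linarith)
  obtain ⟨q, hqt, hyq, hqz⟩ := ht.exists_mem (a := g) hlt.le (by linarith)
  have h3 := hX p z x y
  have h4 := hX p q y z
  rw [dist_comm p x, dist_comm z y, dist_comm z x] at h3
  rw [dist_comm q y] at h4
  have hpz : dist p z ≤ dist y z - g := by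
    rcases le_max_iff.1 h3 with h | h <;> linarith
  have hpq : dist p q ≤ 0 := by
    rcases le_max_iff.1 h4 with h | h <;> linarith
  obtain rfl := dist_le_zero.1 hpq
  have : p ∈ s ∩ t := ⟨hps, hqt⟩
  rw [hst, Set.mem_singleton_iff] at this
  subst this
  rw [dist_self] at hyq
  linarith

/-- A geodesic metric space satisfying the four point condition is an ℝ-tree. -/
theorem FourPoint.isRTree (hX : FourPoint X) (hc : GeodesicallyConnected X) : IsRTree X := by
  refine ⟨fun x y => ?_, fun s t x y z hs ht hst => ?_⟩
  · obtain ⟨s, hs⟩ := hc x y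
    exact ⟨s, hs, fun t ht => (hX.segment_eq ht).trans (hX.segment_eq hs).symm⟩
  · have hd := hX.dist_eq_add hs ht hst
    obtain ⟨w, hw⟩ := hc x z
    suffices s ∪ t = w by rwa [this]
    have hyw : y ∈ w := by
      rw [hX.segment_eq hw]; exact hd.symm
    refine Set.Subset.antisymm ?_ ?_
    · rw [hX.segment_eq hs, hX.segment_eq ht, hX.segment_eq hw]
      rintro a (ha | ha) <;> simp only [Set.mem_ofPred_eq] at ha ⊢
      · linarith [dist_triangle a y z, dist_triangle x a z]
      · linarith [dist_triangle x y a, dist_triangle x a z]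
    · rw [hX.segment_eq hs, hX.segment_eq ht]
      obtain ⟨γ, b, hb, hγ, rfl, rfl, rfl⟩ := hw
      obtain ⟨c, hc, rfl⟩ := hyw
      rintro _ ⟨u, hu, rfl⟩
      have h0 : (0 : ℝ) ∈ Set.Icc 0 b := ⟨le_rfl, hb⟩
      have h1 : b ∈ Set.Icc 0 b := ⟨hb, le_rfl⟩
      simp only [Set.mem_union, Set.mem_ofPred_eq]
      rw [hγ _ h0 _ hu, hγ _ hu _ hc, hγ _ h0 _ hc, hγ _ hc _ hu, hγ _ hu _ h1, hγ _ hc _ h1]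
      simp only [Set.mem_Icc] at hu hc
      rcases le_total u c with h | h
      · left
        rw [abs_of_nonpos, abs_of_nonpos, abs_of_nonpos] <;> linarith
      · right
        rw [abs_of_nonpos, abs_of_nonpos, abs_of_nonpos] <;> linarith

theorem FourPoint.leafless (hX : FourPoint X) (hc : GeodesicallyConnected X)
    (h : ∀ p q : X, ∃ q', dist q q' = 1 ∧ dist p q' = dist p q + 1) : Leafless X := by
  intro x y s hs
  obtain ⟨y', hy, hy'⟩ := h x y
  obtain ⟨x', hx, hx'⟩ := h y' x
  obtain ⟨w, hw⟩ := hc x' y'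
  rw [dist_comm y' x', dist_comm y' x] at hx'
  rw [dist_comm x x'] at hx
  refine ⟨x', y', w, hw, ?_, by rw [hx]; norm_num, by rw [hy]; norm_num, by linarith⟩
  rw [hX.segment_eq hs, hX.segment_eq hw]
  intro z hz
  simp only [Set.mem_ofPred_eq] at hz ⊢
  linarith [dist_triangle x' x z, dist_triangle z y y', dist_triangle x' z y']

/-- Two rays meeting in arbitrarily far corresponding points intersect in a ray. -/
theorem FourPoint.isRay_inter (hX : FourPoint X) {γ δ : ℝ → X} {k S : ℝ}
    (hγ : ∀ u ∈ Set.Ici (0 : ℝ), ∀ v ∈ Set.Ici (0 : ℝ), dist (γ u) (γ v) = |u - v|)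
    (hδ : ∀ u ∈ Set.Ici (0 : ℝ), ∀ v ∈ Set.Ici (0 : ℝ), dist (δ u) (δ v) = |u - v|)
    (h : ∀ s ≥ S, 0 ≤ s ∧ 0 ≤ s + k ∧ γ s = δ (s + k)) :
    IsRay (γ '' Set.Ici 0 ∩ δ '' Set.Ici 0) := by
  simp only [Set.mem_Ici] at hγ hδ
  set A : Set ℝ := {t | 0 ≤ t ∧ 0 ≤ t + k ∧ γ t = δ (t + k)}
  have hSA : S ∈ A := h S le_rfl
  have hbdd : BddBelow A := ⟨0, fun t ht => ht.1⟩
  have hup : ∀ t ∈ A, ∀ u, t ≤ u → u ∈ A := by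
    rintro t ⟨ht, htk, hte⟩ u htu
    refine ⟨by linarith, by linarith, ?_⟩
    obtain ⟨hw, hwk, hwe⟩ := h (max S u) (le_max_left _ _)
    have huw : u ≤ max S u := le_max_right _ _
    set w := max S u
    refine hX.eq_of_dist_eq (p := γ t) (q := γ w) ?_ ?_ ?_
    · rw [hγ _ ht _ (by linarith), hγ _ (by linarith) _ hw, hγ _ ht _ hw,
        abs_of_nonpos, abs_of_nonpos, abs_of_nonpos] <;> linarith
    · rw [hγ _ ht _ (by linarith), hte, hδ _ htk _ (by linarith)]
      congr 1; ring
    · rw [hγ _ (by linarith) _ hw, hwe, hδ _ (by linarith) _ hwk]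
      congr 1; ring
  have haA : sInf A ∈ A := by
    have h0 : 0 ≤ sInf A := le_csInf ⟨S, hSA⟩ fun t ht => ht.1
    have h1 : 0 ≤ sInf A + k := by
      have : -k ≤ sInf A := le_csInf ⟨S, hSA⟩ fun t ht => by linarith [ht.2.1]
      linarith
    refine ⟨h0, h1, ?_⟩
    refine eq_of_forall_dist_le fun ε hε => ?_
    obtain ⟨t, htA, ht⟩ := exists_lt_of_csInf_lt ⟨S, hSA⟩ (show sInf A < sInf A + ε / 2 by linarith)
    have hle : sInf A ≤ t := csInf_le hbdd htA
    have htri := dist_triangle (γ (sInf A)) (γ t) (δ (sInf A + k))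
    rw [hγ _ h0 _ htA.1, htA.2.2, hδ _ htA.2.1 _ h1, abs_of_nonpos (by linarith),
      abs_of_nonneg (by linarith)] at htri
    linarith
  set a := sInf A
  refine ⟨fun t => γ (a + t), fun u hu v hv => ?_, ?_⟩
  · simp only [Set.mem_Ici] at hu hv
    rw [hγ _ (by linarith [haA.1]) _ (by linarith [haA.1])]
    congr 1; ring
  · ext z
    constructor
    · rintro ⟨⟨t, ht, rfl⟩, t', ht', hte⟩
      simp only [Set.mem_Ici] at ht ht'
      have htA : t ∈ A := by
        obtain ⟨hw, hwk, hwe⟩ := h (max S (max t (t' - k))) (le_max_left _ _)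
        have h1 : t ≤ max S (max t (t' - k)) := le_max_of_le_right (le_max_left _ _)
        have h2 : t' - k ≤ max S (max t (t' - k)) := le_max_of_le_right (le_max_right _ _)
        set w := max S (max t (t' - k))
        have h3 := hγ _ ht _ hw
        rw [← hte, hwe, hδ _ ht' _ hwk, abs_of_nonpos (by linarith),
          abs_of_nonpos (by linarith)] at h3
        obtain rfl : t' = t + k := by linarith
        exact ⟨ht, ht', hte.symm⟩
      exact ⟨t - a, sub_nonneg.2 (csInf_le hbdd htA), by simp⟩
    · rintro ⟨t, ht, rfl⟩
      simp only [Set.mem_Ici] at ht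
      have := hup a haA (a + t) (by linarith)
      exact ⟨⟨_, this.1, rfl⟩, _, this.2.1, this.2.2.symm⟩

end FourPoint

/-- A complete discrete valuation on a field; the trivial valuation is allowed. -/
structure DiscVal (K : Type) [Field K] where
  /-- The valuation, whose value at `0` is irrelevant. -/
  v : K → ℤ
  v_mul : ∀ x y, x ≠ 0 → y ≠ 0 → v (x * y) = v x + v y
  min_le : ∀ x y, x ≠ 0 → y ≠ 0 → x + y ≠ 0 → min (v x) (v y) ≤ v (x + y)
  complete : ∀ x : ℕ → K, (∀ n, x n = x (n + 1) ∨ (n : ℤ) ≤ v (x n - x (n + 1))) →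
    ∃ y, ∀ n, x n = y ∨ (n : ℤ) - 1 ≤ v (x n - y)

namespace DiscVal

variable {K : Type} [Field K] (V : DiscVal K)

theorem v_one : V.v 1 = 0 := by
  have := V.v_mul 1 1 one_ne_zero one_ne_zero
  rw [one_mul] at this
  linarith

theorem v_neg (x : K) (hx : x ≠ 0) : V.v (-x) = V.v x := by
  have h : (-1 : K) ≠ 0 := neg_ne_zero.2 one_ne_zero
  have h1 := V.v_mul (-1) (-1) h h
  rw [neg_one_mul, neg_neg, v_one] at h1
  have h2 := V.v_mul (-1) x h hx
  rw [neg_one_mul] at h2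
  linarith

theorem v_sub_comm {x y : K} (h : x ≠ y) : V.v (x - y) = V.v (y - x) := by
  rw [← V.v_neg _ (sub_ne_zero.2 h), neg_sub]

theorem v_inv {x : K} (hx : x ≠ 0) : V.v x⁻¹ = -V.v x := by
  have := V.v_mul x x⁻¹ hx (inv_ne_zero hx)
  rw [mul_inv_cancel₀ hx, v_one] at this
  linarith

theorem v_inv_sub_inv {x y : K} (hx : x ≠ 0) (hy : y ≠ 0) (h : x ≠ y) :
    V.v (x⁻¹ - y⁻¹) = V.v (x - y) - V.v x - V.v y := by
  have hxy := sub_ne_zero.2 h.symm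
  rw [inv_sub_inv hx hy, div_eq_mul_inv, V.v_mul _ _ hxy (inv_ne_zero (mul_ne_zero hx hy)),
    V.v_inv (mul_ne_zero hx hy), V.v_mul _ _ hx hy, V.v_sub_comm h]
  ring

/-- `x` and `y` lie in a common ball of valuative radius `r`. -/
def Close (r : ℝ) (x y : K) : Prop := x = y ∨ r ≤ V.v (x - y)

variable {V}

theorem Close.refl (r : ℝ) (x : K) : V.Close r x x := Or.inl rfl

theorem Close.symm {r : ℝ} {x y : K} (h : V.Close r x y) : V.Close r y x := by
  by_cases hxy : x = y
  · exact Or.inl hxy.symm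
  · refine h.imp Eq.symm fun h => ?_
    rwa [V.v_sub_comm (Ne.symm hxy)]

theorem Close.mono {r r' : ℝ} {x y : K} (h : V.Close r x y) (hr : r' ≤ r) : V.Close r' x y :=
  h.imp id hr.trans

theorem Close.trans {r : ℝ} {x y z : K} (h : V.Close r x y) (h' : V.Close r y z) :
    V.Close r x z := by
  by_cases hxy : x = y
  · rwa [hxy]
  by_cases hyz : y = z
  · rwa [← hyz]
  by_cases hxz : x = z
  · exact Or.inl hxz
  have h1 := h.resolve_left hxy
  have h2 := h'.resolve_left hyz
  have := V.min_le (x - y) (y - z) (sub_ne_zero.2 hxy) (sub_ne_zero.2 hyz)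
    (by rw [sub_add_sub_cancel]; exact sub_ne_zero.2 hxz)
  rw [sub_add_sub_cancel] at this
  right
  rcases min_le_iff.1 this with h | h
  · exact h1.trans (by exact_mod_cast h)
  · exact h2.trans (by exact_mod_cast h)

theorem exists_close (x y : K) : ∃ r, V.Close r x y := ⟨_, Or.inr le_rfl⟩

theorem eq_of_close {x y : K} {r : ℝ} (h : V.Close r x y) (hr : V.v (x - y) < r) : x = y :=
  h.resolve_right (not_le.2 hr)

variable (V)

open Classical in
/-- The height at which the two vertical lines issued from `p` and `q` meet. -/
noncomputable def confl (p q : K × ℝ) : ℝ :=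
  if p.1 = q.1 then min p.2 q.2 else min (min p.2 q.2) (V.v (p.1 - q.1))

variable {V}

theorem le_confl {p q : K × ℝ} {r : ℝ} :
    r ≤ V.confl p q ↔ r ≤ p.2 ∧ r ≤ q.2 ∧ V.Close r p.1 q.1 := by
  unfold confl Close
  split_ifs with h <;> simp [h, and_assoc]

theorem confl_le_left (p q : K × ℝ) : V.confl p q ≤ p.2 := (le_confl.1 le_rfl).1

theorem confl_le_right (p q : K × ℝ) : V.confl p q ≤ q.2 := (le_confl.1 le_rfl).2.1

theorem close_confl (p q : K × ℝ) : V.Close (V.confl p q) p.1 q.1 := (le_confl.1 le_rfl).2.2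

theorem confl_comm (p q : K × ℝ) : V.confl p q = V.confl q p := by
  refine eq_of_forall_le_iff fun r => ?_
  rw [le_confl, le_confl]
  exact ⟨fun h => ⟨h.2.1, h.1, h.2.2.symm⟩, fun h => ⟨h.2.1, h.1, h.2.2.symm⟩⟩

theorem confl_ultra (p q r : K × ℝ) : min (V.confl p q) (V.confl q r) ≤ V.confl p r :=
  le_confl.2 ⟨(min_le_left _ _).trans (confl_le_left _ _),
    (min_le_right _ _).trans (confl_le_right _ _),
    ((close_confl p q).mono (min_le_left _ _)).trans ((close_confl q r).mono (min_le_right _ _))⟩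

theorem confl_self (p : K × ℝ) : V.confl p p = p.2 := by simp [confl]

theorem confl_of_close {x y : K} {s t : ℝ} (h : V.Close s x y) (hst : s ≤ t) :
    V.confl (x, s) (y, t) = s :=
  le_antisymm (confl_le_left _ _) (le_confl.2 ⟨le_rfl, hst, h⟩)

theorem confl_of_le {p q : K × ℝ} (h : p.1 ≠ q.1) (hp : V.v (p.1 - q.1) ≤ p.2)
    (hq : V.v (p.1 - q.1) ≤ q.2) : V.confl p q = V.v (p.1 - q.1) := by
  rw [confl, if_neg h, min_eq_right (le_min hp hq)]

variable (V)

/-- Pairs (centre, height), representing the points of the tree of balls. -/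
def Pre (_ : DiscVal K) : Type := K × ℝ

noncomputable instance : PseudoMetricSpace (Pre V) where
  dist := fun (p q : K × ℝ) => p.2 + q.2 - 2 * V.confl p q
  dist_self := fun (p : K × ℝ) => by
    rw [confl_self]; ring
  dist_comm := fun (p q : K × ℝ) => by
    rw [confl_comm]; ring
  dist_triangle := fun (p q r : K × ℝ) => by
    have h := confl_ultra (V := V) p q r
    have h1 := confl_le_right (V := V) p q
    have h2 := confl_le_left (V := V) q r
    rcases min_le_iff.1 h with h | h <;> linarith

/-- The tree of balls of a discretely valued field. -/
abbrev Tree : Type := SeparationQuotient (Pre V)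

/-- The ball of centre `x` and height `s`. -/
noncomputable def pt (x : K) (s : ℝ) : Tree V := SeparationQuotient.mk (show Pre V from (x, s))

variable {V}

theorem dist_pt (x y : K) (s t : ℝ) :
    dist (V.pt x s) (V.pt y t) = s + t - 2 * V.confl (x, s) (y, t) :=
  SeparationQuotient.dist_mk _ _

theorem exists_pt (p : Tree V) : ∃ x s, p = V.pt x s := by
  obtain ⟨⟨x, s⟩, rfl⟩ := SeparationQuotient.surjective_mk p
  exact ⟨x, s, rfl⟩

theorem pt_eq_pt {x y : K} {s t : ℝ} : V.pt x s = V.pt y t ↔ s = t ∧ V.Close s x y := by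
  rw [← dist_eq_zero, dist_pt]
  have h1 := confl_le_left (V := V) (x, s) (y, t)
  have h2 := confl_le_right (V := V) (x, s) (y, t)
  constructor
  · intro h
    simp only at h1 h2
    have hs : V.confl (x, s) (y, t) = s := by linarith
    refine ⟨by linarith, ?_⟩
    have := close_confl (V := V) (x, s) (y, t)
    rwa [hs] at this
  · rintro ⟨rfl, h⟩
    rw [confl_of_close h le_rfl]; ring

theorem dist_pt_same (x : K) (s t : ℝ) : dist (V.pt x s) (V.pt x t) = |s - t| := by
  rw [dist_pt]
  rcases le_total s t with h | h
  · rw [confl_of_close (Close.refl _ _) h, abs_of_nonpos (by linarith)]; ring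
  · rw [confl_comm, confl_of_close (Close.refl _ _) h, abs_of_nonneg (by linarith)]; ring

theorem fourPoint : FourPoint (Tree V) := by
  intro p q r s
  obtain ⟨p, a, rfl⟩ := exists_pt p
  obtain ⟨q, b, rfl⟩ := exists_pt q
  obtain ⟨r, c, rfl⟩ := exists_pt r
  obtain ⟨s, d, rfl⟩ := exists_pt s
  simp only [dist_pt]
  generalize hp : (p, a) = p'
  generalize hq : (q, b) = q'
  generalize hr : (r, c) = r'
  generalize hs : (s, d) = s'
  have h1 := confl_ultra (V := V) p' r' q'
  have h2 := confl_ultra (V := V) p' s' q'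
  have h3 := confl_ultra (V := V) r' p' s'
  have h4 := confl_ultra (V := V) r' q' s'
  rw [confl_comm r' q'] at *
  rw [confl_comm s' q'] at *
  rw [confl_comm r' p'] at *
  rw [le_max_iff]
  by_contra! hcon
  obtain ⟨h5, h6⟩ := hcon
  rcases min_le_iff.1 h1 with h1 | h1 <;> rcases min_le_iff.1 h2 with h2 | h2 <;>
  rcases min_le_iff.1 h3 with h3 | h3 <;> rcases min_le_iff.1 h4 with h4 | h4 <;> linarith

theorem geodesicallyConnected : GeodesicallyConnected (Tree V) := by
  intro p q
  obtain ⟨x, s, rfl⟩ := exists_pt p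
  obtain ⟨y, t, rfl⟩ := exists_pt q
  have hs := confl_le_left (V := V) (x, s) (y, t)
  have ht := confl_le_right (V := V) (x, s) (y, t)
  have hcl := close_confl (V := V) (x, s) (y, t)
  have hmono : ∀ a b, V.confl (x, s) (y, t) ≤ a → V.confl (x, s) (y, t) ≤ b → a ≤ s → b ≤ t →
      V.confl (x, a) (y, b) = V.confl (x, s) (y, t) := by
    intro a b ha hb has hbt
    refine le_antisymm (le_confl.2 ⟨?_, ?_, close_confl (x, a) (y, b)⟩) (le_confl.2 ⟨ha, hb, hcl⟩)
    · exact (confl_le_left _ _).trans has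
    · exact (confl_le_right _ _).trans hbt
  set g := V.confl (x, s) (y, t)
  simp only at hs ht hcl
  have hmix : ∀ u w, 0 ≤ u → u ≤ s - g → s - g ≤ w → w ≤ s + t - 2 * g →
      dist (V.pt x (s - u)) (V.pt y (2 * g - s + w)) = w - u := by
    intro u w h1 h2 h3 h4
    rw [dist_pt, hmono] <;> linarith
  refine ⟨_, fun u : ℝ => if u ≤ s - g then V.pt x (s - u) else V.pt y (2 * g - s + u),
    s + t - 2 * g, by linarith, ?_, by simp [hs], ?_, rfl⟩
  · rintro u ⟨hu, hu'⟩ w ⟨hw, hw'⟩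
    simp only
    split_ifs with h1 h2 h2
    · rw [dist_pt_same, abs_sub_comm]; congr 1; ring
    · rw [hmix u w hu h1 (by linarith) hw', abs_of_nonpos] <;> linarith
    · rw [dist_comm, hmix w u hw h2 (by linarith) hu', abs_of_nonneg] ; linarith
    · rw [dist_pt_same]; congr 1; ring
  · simp only
    split_ifs with h
    · have : t = g := by linarith
      rw [pt_eq_pt]
      exact ⟨by linarith, hcl.mono (by linarith)⟩
    · congr 1; ring

theorem exists_extension (p q : Tree V) :
    ∃ q', dist q q' = 1 ∧ dist p q' = dist p q + 1 := by
  obtain ⟨x, s, rfl⟩ := exists_pt p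
  obtain ⟨y, t, rfl⟩ := exists_pt q
  rcases (confl_le_right (V := V) (x, s) (y, t)).eq_or_lt with h | h <;> simp only at h
  · refine ⟨V.pt y (t - 1), by simp [dist_pt_same], ?_⟩
    rw [dist_pt, dist_pt, h]
    have := le_confl.1 h.ge
    rw [confl_comm, confl_of_close (this.2.2.symm.mono (by simp)) (by simp; linarith [this.1])]
    ring
  · refine ⟨V.pt y (t + 1), by simp [dist_pt_same], ?_⟩
    have : V.confl (x, s) (y, t + 1) = V.confl (x, s) (y, t) := by
      have hc := close_confl (V := V) (x, s) (y, t + 1)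
      have hl := confl_le_left (V := V) (x, s) (y, t + 1)
      refine le_antisymm ?_ (le_confl.2 ⟨confl_le_left _ _, ?_, close_confl (x, s) (y, t)⟩)
      · by_contra! hlt
        have : min (V.confl (x, s) (y, t + 1)) t ≤ V.confl (x, s) (y, t) :=
          le_confl.2 ⟨(min_le_left _ _).trans hl, min_le_right _ _, hc.mono (min_le_left _ _)⟩
        rcases min_le_iff.1 this with h' | h' <;> linarith
      · simp only; linarith
    rw [dist_pt, dist_pt, this]; ring

theorem leafless : Leafless (Tree V) :=
  fourPoint.leafless geodesicallyConnected exists_extension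

theorem isUnitSimplicialTree : IsUnitSimplicialTree (Tree V) := by
  refine ⟨fourPoint.isRTree geodesicallyConnected, {p | ∃ (x : K) (n : ℤ), p = V.pt x n}, ?_, ?_⟩
  · rintro _ ⟨x, m, rfl⟩ _ ⟨y, n, rfl⟩
    have h_int : ∃ k : ℤ, V.confl (x, (m : ℝ)) (y, (n : ℝ)) = k := by
      unfold confl
      split_ifs
      · exact ⟨min m n, by simp⟩
      · exact ⟨min (min m n) (V.v (x - y)), by push_cast; rfl⟩
    obtain ⟨k, hk⟩ := h_int
    have hd := dist_pt (V := V) x y m n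
    have h0 := dist_nonneg (x := V.pt x m) (y := V.pt y n)
    rw [hk] at hd
    have hd' : dist (V.pt x m) (V.pt y n) = ((m + n - 2 * k : ℤ) : ℝ) := by push_cast; exact hd
    rw [hd'] at h0 ⊢
    lift m + n - 2 * k to ℕ using (by exact_mod_cast h0) with j
    exact ⟨j, by simp⟩
  · intro p
    obtain ⟨x, s, rfl⟩ := exists_pt p
    refine ⟨_, ⟨x, ⌊s⌋, rfl⟩, _, ⟨x, ⌊s⌋ + 1, rfl⟩, ?_, ?_⟩
    · rw [dist_pt_same]; simp
    · rw [dist_pt_same, dist_pt_same]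
      have h1 := Int.floor_le s
      have h2 := Int.lt_floor_add_one s
      push_cast
      rw [abs_of_nonpos, abs_of_nonpos] <;> linarith

end DiscVal

theorem exists_shift_of_subset_ray {X : Type*} [MetricSpace X] {γ f : ℝ → X} {S : ℝ}
    (hγ : ∀ u ∈ Set.Ici (0 : ℝ), ∀ v ∈ Set.Ici (0 : ℝ), dist (γ u) (γ v) = |u - v|)
    (hf : ∀ s t, dist (f s) (f t) = |s - t|) (h : ∀ s ≥ S, f s ∈ γ '' Set.Ici 0) :
    ∃ c S', ∀ s ≥ S', 0 ≤ s + c ∧ γ (s + c) = f s := by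
  obtain ⟨a, ha, hae⟩ := h S le_rfl
  simp only [Set.mem_Ici] at ha hγ
  refine ⟨a - S, S + a + 1, fun s hs => ?_⟩
  obtain ⟨b, hb, hbe⟩ := h s (by linarith)
  simp only [Set.mem_Ici] at hb
  have hd := hγ a ha b hb
  rw [hae, hbe, hf, abs_of_nonpos (by linarith)] at hd
  rcases abs_cases (a - b) with ⟨h1, -⟩ | ⟨h1, -⟩
  · linarith
  · obtain rfl : b = s + (a - S) := by linarith
    exact ⟨hb, hbe⟩

namespace DiscVal

variable {K : Type} [Field K] (V : DiscVal K)

/-- The vertical geodesic line pointing to an element of `K` or to infinity. -/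
noncomputable def line : Option K → ℝ → Tree V
  | none, s => V.pt 0 (-s)
  | some x, s => V.pt x s

/-- The set `R` contains a subray of the line pointing to `o`. -/
def Tends (R : Set (Tree V)) (o : Option K) : Prop := ∃ S, ∀ s ≥ S, V.line o s ∈ R

/-- The end of the tree corresponding to a point of the projective line. -/
def endOf (o : Option K) : Set (Set (Tree V)) := {R | IsRay R ∧ V.Tends R o}

variable {V}

theorem dist_line (o : Option K) (s t : ℝ) : dist (V.line o s) (V.line o t) = |s - t| := by
  cases o with
  | none => simp only [line, dist_pt_same, abs_sub_comm s t]; congr 1; ring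
  | some x => exact dist_pt_same _ _ _

theorem line_separated {o o' : Option K} (h : o ≠ o') :
    ∃ N, ∀ s ≥ N, ∀ t ≥ N, V.line o s ≠ V.line o' t := by
  cases o with
  | none =>
    cases o' with
    | none => exact absurd rfl h
    | some y =>
      refine ⟨1, fun s hs t ht he => ?_⟩
      have := (pt_eq_pt.1 he).1
      linarith
  | some x =>
    cases o' with
    | none =>
      refine ⟨1, fun s hs t ht he => ?_⟩
      have := (pt_eq_pt.1 he).1
      linarith
    | some y =>
      refine ⟨V.v (x - y) + 1, fun s hs t ht he => h ?_⟩
      rw [eq_of_close (pt_eq_pt.1 he).2 (by linarith)]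

theorem tends_line (o : Option K) : V.Tends (V.line o '' Set.Ici 0) o :=
  ⟨0, fun s hs => ⟨s, hs, rfl⟩⟩

theorem isRay_line (o : Option K) : IsRay (V.line o '' Set.Ici 0) :=
  ⟨V.line o, fun _ _ _ _ => dist_line _ _ _, rfl⟩

theorem Tends.mono {R R' : Set (Tree V)} {o : Option K} (h : V.Tends R o) (hR : R ⊆ R') :
    V.Tends R' o := by
  obtain ⟨S, hS⟩ := h
  exact ⟨S, fun s hs => hR (hS s hs)⟩

theorem Tends.unique {R : Set (Tree V)} {o o' : Option K} (hR : IsRay R) (h : V.Tends R o)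
    (h' : V.Tends R o') : o = o' := by
  obtain ⟨γ, hγ, rfl⟩ := hR
  obtain ⟨S, hS⟩ := h
  obtain ⟨S', hS'⟩ := h'
  obtain ⟨c, A, hA⟩ := exists_shift_of_subset_ray hγ (dist_line o) hS
  obtain ⟨c', A', hA'⟩ := exists_shift_of_subset_ray hγ (dist_line o') hS'
  by_contra hne
  obtain ⟨N, hN⟩ := line_separated (V := V) hne
  obtain ⟨M, hM⟩ : ∃ M : ℝ, A + c ≤ M ∧ A' + c' ≤ M ∧ N + c ≤ M ∧ N + c' ≤ M :=
    ⟨max (max (A + c) (A' + c')) (max (N + c) (N + c')), by simp⟩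
  refine hN (M - c) (by linarith) (M - c') (by linarith) ?_
  rw [← (hA (M - c) (by linarith)).2, ← (hA' (M - c') (by linarith)).2]
  congr 1; ring

theorem exists_tends {R : Set (Tree V)} (hR : IsRay R) : ∃ o, V.Tends R o := by
  obtain ⟨γ, hγ, rfl⟩ := hR
  simp only [Set.mem_Ici] at hγ
  choose x h hxh using fun t => exists_pt (γ t)
  have hd : ∀ s t, 0 ≤ s → s ≤ t → t - s = h s + h t - 2 * V.confl (x s, h s) (x t, h t) := by
    intro s t hs hst
    rw [← dist_pt, ← hxh, ← hxh, hγ s hs t (hs.trans hst), abs_of_nonpos (by linarith)]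
    ring
  by_cases hdown : ∀ t ≥ 0, h t = h 0 - t
  · refine ⟨none, ?_⟩
    obtain ⟨r, hr⟩ := exists_close (V := V) 0 (x 0)
    refine ⟨max (-h 0) (-r), fun s hs => ⟨s + h 0, ?_, ?_⟩⟩
    · have := (le_max_left _ _).trans hs
      simp only [Set.mem_Ici]; linarith
    have h0 : 0 ≤ s + h 0 := by linarith [(le_max_left _ _).trans hs]
    have h1 : -s ≤ r := by linarith [(le_max_right _ _).trans hs]
    have h2 := hd 0 _ le_rfl h0
    have h3 := hdown _ h0
    rw [hxh, line, pt_eq_pt]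
    refine ⟨by linarith, ?_⟩
    have hc := close_confl (V := V) (x 0, h 0) (x (s + h 0), h (s + h 0))
    exact ((hc.mono (by linarith)).symm).trans ((hr.mono (by linarith)).symm)
  · push Not at hdown
    obtain ⟨t₀, ht₀, hne⟩ := hdown
    have hlt : h 0 - t₀ < h t₀ := by
      have h1 := hd 0 t₀ le_rfl ht₀
      have h2 := confl_le_left (V := V) (x 0, h 0) (x t₀, h t₀)
      have h3 := confl_le_right (V := V) (x 0, h 0) (x t₀, h t₀)
      simp only at h2 h3
      exact lt_of_le_of_ne (by linarith) hne.symm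
    have hup : ∀ t ≥ t₀, h t = h t₀ + (t - t₀) := by
      intro t ht
      have h1 := hd 0 t₀ le_rfl ht₀
      have h2 := hd t₀ t ht₀ ht
      have h3 := hd 0 t le_rfl (ht₀.trans ht)
      have u1 := confl_ultra (V := V) (x 0, h 0) (x t₀, h t₀) (x t, h t)
      have u2 := confl_ultra (V := V) (x 0, h 0) (x t, h t) (x t₀, h t₀)
      rw [confl_comm (x t, h t) (x t₀, h t₀)] at u2
      rcases min_le_iff.1 u1 with u1 | u1 <;> rcases min_le_iff.1 u2 with u2 | u2 <;> linarith
    have hclose : ∀ s t, t₀ ≤ s → s ≤ t → V.Close (h s) (x s) (x t) := by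
      intro s t hs hst
      have h1 := hd s t (ht₀.trans hs) hst
      have h2 := hup s hs
      have h3 := hup t (hs.trans hst)
      exact (close_confl (V := V) (x s, h s) (x t, h t)).mono (by linarith)
    obtain ⟨m, hm⟩ := exists_nat_ge (h t₀)
    have hτ : ∀ n : ℕ, t₀ ≤ t₀ + (((m : ℝ) + n) - h t₀) := fun n => by
      have : (0 : ℝ) ≤ n := Nat.cast_nonneg n
      linarith
    set τ : ℕ → ℝ := fun n => t₀ + (((m : ℝ) + n) - h t₀)
    have hhτ : ∀ n, h (τ n) = m + n := fun n => by rw [hup _ (hτ n)]; ring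
    obtain ⟨y, hy⟩ := V.complete (fun n => x (τ n)) (fun n => by
      have := hclose (τ n) (τ (n + 1)) (hτ n) (by simp only [τ]; push_cast; linarith)
      rw [hhτ] at this
      have h2 : V.Close ((n : ℤ) : ℝ) (x (τ n)) (x (τ (n + 1))) := this.mono (by simp)
      exact h2.imp id fun h => by exact_mod_cast h)
    refine ⟨some y, h t₀, fun s hs => ⟨t₀ + (s - h t₀), ?_, ?_⟩⟩
    · simp only [Set.mem_Ici]; linarith
    have hst : t₀ ≤ t₀ + (s - h t₀) := by linarith
    have hhs := hup _ hst
    set w := t₀ + (s - h t₀)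
    obtain ⟨n, hn⟩ := exists_nat_ge (s + 1)
    have h1 := hclose w (τ n) hst (by
      simp only [τ, w]
      have : (0 : ℝ) ≤ m := Nat.cast_nonneg m
      linarith)
    have h2 : V.Close ((n : ℝ) - 1) (x (τ n)) y := (hy n).imp id fun h => by exact_mod_cast h
    rw [hxh, line, pt_eq_pt]
    exact ⟨by linarith, h1.trans (h2.mono (by linarith))⟩

theorem isRay_inter_of_tends {R R' : Set (Tree V)} {o : Option K} (hR : IsRay R)
    (hR' : IsRay R') (h : V.Tends R o) (h' : V.Tends R' o) : IsRay (R ∩ R') := by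
  obtain ⟨γ, hγ, rfl⟩ := hR
  obtain ⟨δ, hδ, rfl⟩ := hR'
  obtain ⟨S, hS⟩ := h
  obtain ⟨S', hS'⟩ := h'
  obtain ⟨c, A, hA⟩ := exists_shift_of_subset_ray hγ (dist_line o) hS
  obtain ⟨c', A', hA'⟩ := exists_shift_of_subset_ray hδ (dist_line o) hS'
  refine fourPoint.isRay_inter (k := c' - c) (S := max (A + c) (A' + c)) hγ hδ fun s hs => ?_
  have h1 := hA (s - c) (by linarith [(le_max_left _ _).trans hs])
  have h2 := hA' (s - c) (by linarith [(le_max_right _ _).trans hs])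
  rw [sub_add_cancel] at h1
  rw [show s - c + c' = s + (c' - c) by ring] at h2
  exact ⟨h1.1, h2.1, h1.2.trans h2.2.symm⟩

theorem end_eq_endOf {R : Set (Tree V)} {o : Option K} (hR : IsRay R) (h : V.Tends R o) :
    {R' : Set (Tree V) | IsRay R' ∧ IsRay (R' ∩ R)} = V.endOf o := by
  ext R'
  refine and_congr_right fun hR' => ⟨fun hi => ?_, fun h' => isRay_inter_of_tends hR' hR h' h⟩
  obtain ⟨o', ho'⟩ := exists_tends hi
  rw [Tends.unique hR h (ho'.mono Set.inter_subset_right)]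
  exact ho'.mono Set.inter_subset_left

theorem isEnd_iff {e : Set (Set (Tree V))} : IsEnd e ↔ ∃ o, e = V.endOf o := by
  constructor
  · rintro ⟨R, hR, rfl⟩
    obtain ⟨o, ho⟩ := exists_tends hR
    exact ⟨o, end_eq_endOf hR ho⟩
  · rintro ⟨o, rfl⟩
    exact ⟨_, isRay_line o, (end_eq_endOf (isRay_line o) (tends_line o)).symm⟩

theorem line_mem_endOf (o : Option K) : V.line o '' Set.Ici 0 ∈ V.endOf o :=
  ⟨isRay_line o, tends_line o⟩

theorem endOf_injective : Function.Injective V.endOf := by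
  intro o o' h
  have h1 := line_mem_endOf (V := V) o
  rw [h] at h1
  exact Tends.unique h1.1 (tends_line o) h1.2

theorem atLeastThreeEnds : AtLeastThreeEnds (Tree V) :=
  ⟨V.endOf none, V.endOf (some 0), V.endOf (some 1), isEnd_iff.2 ⟨_, rfl⟩, isEnd_iff.2 ⟨_, rfl⟩,
    isEnd_iff.2 ⟨_, rfl⟩, endOf_injective.ne (by simp), endOf_injective.ne (by simp),
    endOf_injective.ne (by simp)⟩

end DiscVal

theorem pushEnd_comp {X Y Z : Type*} (φ : Y → Z) (ψ : X → Y) (e : Set (Set X)) :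
    pushEnd (φ ∘ ψ) e = pushEnd φ (pushEnd ψ e) := by
  simp only [pushEnd, Set.image_image, Set.image_comp]

theorem pushEnd_id {X : Type*} (e : Set (Set X)) : pushEnd id e = e := by
  simp [pushEnd]

theorem IsRay.image {X Y : Type*} [MetricSpace X] [MetricSpace Y] {φ : X → Y} (hφ : Isometry φ)
    {R : Set X} (hR : IsRay R) : IsRay (φ '' R) := by
  obtain ⟨γ, hγ, rfl⟩ := hR
  refine ⟨φ ∘ γ, fun u hu v hv => ?_, ?_⟩
  · rw [Function.comp_apply, Function.comp_apply, hφ.dist_eq, hγ u hu v hv]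
  · rw [Set.image_comp]

namespace DiscVal

variable {K : Type} [Field K] (V : DiscVal K)

/-- The isometry `g` acts on the ends as the permutation `π` of the projective line. -/
def ActsAs (g : Tree V ≃ᵢ Tree V) (π : Equiv.Perm (Option K)) : Prop :=
  ∀ o, pushEnd (⇑g) (V.endOf o) = V.endOf (π o)

variable {V}

theorem ActsAs.one : V.ActsAs 1 1 := fun _ => pushEnd_id _

theorem ActsAs.mul {g h : Tree V ≃ᵢ Tree V} {π τ : Equiv.Perm (Option K)} (hg : V.ActsAs g π)
    (hh : V.ActsAs h τ) : V.ActsAs (g * h) (π * τ) := fun o => by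
  rw [IsometryEquiv.coe_mul, pushEnd_comp, hh, hg, Equiv.Perm.mul_apply]

theorem ActsAs.inv {g : Tree V ≃ᵢ Tree V} {π : Equiv.Perm (Option K)} (hg : V.ActsAs g π) :
    V.ActsAs g⁻¹ π⁻¹ := fun o => by
  have h := hg (π⁻¹ o)
  rw [show π (π⁻¹ o) = o from π.apply_symm_apply o] at h
  rw [← h, ← pushEnd_comp, ← IsometryEquiv.coe_mul, inv_mul_cancel]
  exact pushEnd_id _

theorem actsAs_of_line {g : Tree V ≃ᵢ Tree V} {π : Equiv.Perm (Option K)}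
    (h : ∀ o, ∃ c S, ∀ s ≥ S, g (V.line o s) = V.line (π o) (s + c)) : V.ActsAs g π := by
  intro o
  obtain ⟨c, S, hS⟩ := h o
  ext R
  constructor
  · rintro ⟨R, ⟨hR, A, hA⟩, rfl⟩
    refine ⟨hR.image g.isometry, max (S + c) (A + c), fun s hs => ?_⟩
    refine ⟨V.line o (s - c), hA _ ?_, ?_⟩
    · linarith [(le_max_right _ _).trans hs]
    · rw [hS _ (by linarith [(le_max_left _ _).trans hs]), sub_add_cancel]
  · rintro ⟨hR, A, hA⟩
    refine ⟨g.symm '' R, ⟨hR.image g.symm.isometry, max S (A - c), fun s hs => ?_⟩, ?_⟩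
    · refine ⟨V.line (π o) (s + c), hA _ ?_, ?_⟩
      · linarith [(le_max_right _ _).trans hs]
      · rw [← hS _ ((le_max_left _ _).trans hs), IsometryEquiv.symm_apply_apply]
    · rw [Set.image_image]; simp

theorem exists_isometryEquiv (F : K → ℝ → Tree V)
    (hF : ∀ x s y t, dist (F x s) (F y t) = dist (V.pt x s) (V.pt y t))
    (hsurj : ∀ y t, ∃ x s, F x s = V.pt y t) :
    ∃ g : Tree V ≃ᵢ Tree V, ∀ x s, g (V.pt x s) = F x s := by
  have hwd : ∀ p q : Pre V, Inseparable p q → F p.1 p.2 = F q.1 q.2 := by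
    rintro ⟨x, s⟩ ⟨y, t⟩ h
    rw [← dist_eq_zero, hF, dist_eq_zero]
    exact SeparationQuotient.mk_eq_mk.2 h
  let φ : Tree V → Tree V := SeparationQuotient.lift (fun p : Pre V => F p.1 p.2) hwd
  have hφ : ∀ x s, φ (V.pt x s) = F x s := fun _ _ => rfl
  have hiso : Isometry φ := Isometry.of_dist_eq fun p q => by
    obtain ⟨x, s, rfl⟩ := exists_pt p
    obtain ⟨y, t, rfl⟩ := exists_pt q
    rw [hφ, hφ, hF]
  have hsur : Function.Surjective φ := fun q => by
    obtain ⟨y, t, rfl⟩ := exists_pt q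
    obtain ⟨x, s, h⟩ := hsurj y t
    exact ⟨V.pt x s, h⟩
  exact ⟨⟨Equiv.ofBijective φ ⟨hiso.injective, hsur⟩, hiso⟩, hφ⟩

variable (V) in
theorem exists_translation (a : K) :
    ∃ g : Tree V ≃ᵢ Tree V, V.ActsAs g (Equiv.optionCongr (Equiv.addRight a)) := by
  obtain ⟨g, hg⟩ := exists_isometryEquiv (V := V) (fun x s => V.pt (x + a) s)
    (fun x s y t => by by_cases h : x = y <;> simp [dist_pt, confl, h])
    (fun y t => ⟨y - a, t, by simp⟩)
  refine ⟨g, actsAs_of_line fun o => ?_⟩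
  cases o with
  | none =>
    obtain ⟨r, hr⟩ := exists_close (V := V) a 0
    refine ⟨0, -r, fun s hs => ?_⟩
    simp only [line, hg, Equiv.optionCongr_apply, Option.map_none, zero_add, add_zero]
    exact pt_eq_pt.2 ⟨rfl, hr.mono (by linarith)⟩
  | some x => exact ⟨0, 0, fun s _ => by simp [line, hg]⟩

open Classical in
/-- Inversion of the projective line. -/
noncomputable def invPerm (K : Type) [Field K] : Equiv.Perm (Option K) :=
  Function.Involutive.toPerm
    (fun o => match o with
      | none => some 0
      | some x => if x = 0 then none else some x⁻¹)
    (fun o => by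
      rcases o with _ | x
      · simp
      · by_cases hx : x = 0 <;> simp [hx])

theorem invPerm_none : invPerm K none = some 0 := rfl

theorem invPerm_zero : invPerm K (some 0) = none := if_pos rfl

theorem invPerm_of_ne {x : K} (hx : x ≠ 0) : invPerm K (some x) = some x⁻¹ :=
  if_neg hx

theorem confl_zero {y : K} (hy : y ≠ 0) {s t : ℝ} (ht : V.v y < t) :
    V.confl (0, s) (y, t) = min s (V.v y) := by
  rw [confl, if_neg (Ne.symm hy)]
  simp only [zero_sub]
  rw [V.v_neg _ hy, min_assoc, min_eq_right ht.le]

theorem v_sub_of_lt {x y : K} (hx : x ≠ 0) (hy : y ≠ 0) (h : V.v x < V.v y) :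
    V.v (x - y) = V.v x := by
  have hne : x ≠ y := by rintro rfl; exact lt_irrefl _ h
  have h1 := V.min_le x (-y) hx (neg_ne_zero.2 hy) (by rwa [← sub_eq_add_neg, sub_ne_zero])
  have h2 := V.min_le (x - y) y (sub_ne_zero.2 hne) hy (by rwa [sub_add_cancel])
  rw [V.v_neg y hy, ← sub_eq_add_neg] at h1
  rw [sub_add_cancel] at h2
  omega

theorem confl_inv {x y : K} (hx : x ≠ 0) (hy : y ≠ 0) {s t : ℝ} (hs : V.v x < s)
    (ht : V.v y < t) : V.confl (x⁻¹, s - 2 * V.v x) (y⁻¹, t - 2 * V.v y) =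
      V.confl (x, s) (y, t) - V.v x - V.v y := by
  wlog hle : V.v x ≤ V.v y generalizing x y s t
  · rw [confl_comm, this hy hx ht hs (le_of_not_ge hle), confl_comm]; ring
  by_cases hxy : x = y
  · subst hxy
    simp only [confl, if_true]
    rw [min_sub_sub_right]; ring
  have hinv : x⁻¹ ≠ y⁻¹ := inv_injective.ne hxy
  have hsub := V.v_inv_sub_inv hx hy hxy
  rcases hle.eq_or_lt with h | h
  · simp only [confl, if_neg hxy, if_neg hinv]
    rw [hsub, ← h]
    push_cast
    rw [min_sub_sub_right, show ((V.v (x - y) : ℝ) - V.v x - V.v x) = V.v (x - y) - 2 * V.v x by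
      ring, min_sub_sub_right]
    ring
  · have h' : (V.v x : ℝ) < V.v y := by exact_mod_cast h
    have hv := v_sub_of_lt hx hy h
    rw [hv] at hsub
    rw [confl_of_le (p := (x, s)) hxy, confl_of_le (p := (x⁻¹, s - 2 * V.v x)) hinv]
    · simp only [hsub, hv]; push_cast; ring
    all_goals simp only [hsub, hv]; push_cast; linarith

theorem dist_inv_zero {y : K} (hy : y ≠ 0) {s t : ℝ} (ht : V.v y < t) :
    dist (V.pt 0 (-s)) (V.pt y⁻¹ (t - 2 * V.v y)) = dist (V.pt 0 s) (V.pt y t) := by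
  rw [dist_pt, dist_pt, confl_zero hy ht, confl_zero (inv_ne_zero hy), V.v_inv hy]
  · push_cast
    rw [min_neg_neg]
    linarith [min_add_max s (V.v y : ℝ)]
  · rw [V.v_inv hy]; push_cast; linarith

variable (V) in
open Classical in
theorem exists_inversion : ∃ g : Tree V ≃ᵢ Tree V, V.ActsAs g (invPerm K) := by
  have hclose : ∀ {x : K} {s : ℝ}, x = 0 ∨ s ≤ V.v x → V.pt x s = V.pt 0 s := fun {x s} h =>
    pt_eq_pt.2 ⟨rfl, h.imp id fun h => by rwa [sub_zero]⟩
  let F : K → ℝ → Tree V := fun x s =>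
    if x = 0 ∨ s ≤ V.v x then V.pt 0 (-s) else V.pt x⁻¹ (s - 2 * V.v x)
  obtain ⟨g, hg⟩ := exists_isometryEquiv F (fun x s y t => by
      simp only [F]
      split_ifs with h1 h2 h2
      · rw [hclose h1, hclose h2, dist_pt_same, dist_pt_same, abs_sub_comm]
        congr 1; ring
      · push Not at h2
        rw [hclose h1, dist_inv_zero h2.1 h2.2]
      · push Not at h1
        rw [hclose h2, dist_comm, dist_inv_zero h1.1 h1.2, dist_comm]
      · push Not at h1 h2
        rw [dist_pt, dist_pt, confl_inv h1.1 h2.1 h1.2 h2.2]; ring)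
    (fun y t => by
      by_cases h : y = 0 ∨ t ≤ V.v y
      · exact ⟨0, -t, by simp [F, hclose h]⟩
      · have h' := h
        push Not at h'
        refine ⟨y⁻¹, t - 2 * V.v y, ?_⟩
        have : ¬ (y⁻¹ = 0 ∨ t - 2 * V.v y ≤ V.v y⁻¹) := by
          rw [V.v_inv h'.1]
          push Not
          refine ⟨inv_ne_zero h'.1, ?_⟩
          push_cast; linarith
        simp only [F, if_neg this, inv_inv, V.v_inv h'.1]
        congr 1
        push_cast; ring)
  refine ⟨g, actsAs_of_line fun o => ?_⟩
  cases o with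
  | none => exact ⟨0, 0, fun s _ => by simp [line, hg, F, invPerm_none]⟩
  | some x =>
    by_cases hx : x = 0
    · subst hx
      exact ⟨0, 0, fun s _ => by simp [line, hg, F, invPerm_zero]⟩
    · refine ⟨-(2 * V.v x), V.v x + 1, fun s hs => ?_⟩
      have : ¬ (x = 0 ∨ s ≤ V.v x) := by
        push Not
        exact ⟨hx, by linarith⟩
      simp [line, hg, F, invPerm_of_ne hx, this, sub_eq_add_neg]

/-- Pairs of isometries of two trees acting compatibly on the projective line. -/
def compatGroup (V W : DiscVal K) :
    Subgroup (Equiv.Perm (Option K) × (Tree V ≃ᵢ Tree V) × (Tree W ≃ᵢ Tree W)) where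
  carrier := {g | V.ActsAs g.2.1 g.1 ∧ W.ActsAs g.2.2 g.1}
  one_mem' := ⟨ActsAs.one, ActsAs.one⟩
  mul_mem' hg hh := ⟨hg.1.mul hh.1, hg.2.mul hh.2⟩
  inv_mem' hg := ⟨hg.1.inv, hg.2.inv⟩

theorem exists_mem_compatGroup_translation (V W : DiscVal K) (a : K) :
    ∃ g ∈ compatGroup V W, g.1 = Equiv.optionCongr (Equiv.addRight a) := by
  obtain ⟨g, hg⟩ := V.exists_translation a
  obtain ⟨h, hh⟩ := W.exists_translation a
  exact ⟨(_, g, h), ⟨hg, hh⟩, rfl⟩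

theorem exists_mem_compatGroup_inversion (V W : DiscVal K) :
    ∃ g ∈ compatGroup V W, g.1 = invPerm K := by
  obtain ⟨g, hg⟩ := V.exists_inversion
  obtain ⟨h, hh⟩ := W.exists_inversion
  exact ⟨(_, g, h), ⟨hg, hh⟩, rfl⟩

theorem exists_mem_compatGroup_base (V W : DiscVal K) {a b : Option K} (hab : a ≠ b) :
    ∃ g ∈ compatGroup V W, g.1 none = a ∧ g.1 (some 0) = b := by
  cases a with
  | none =>
    cases b with
    | none => exact absurd rfl hab
    | some y =>
      obtain ⟨g, hg, h⟩ := exists_mem_compatGroup_translation V W y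
      exact ⟨g, hg, by simp [h], by simp [h]⟩
  | some x =>
    obtain ⟨σ, hσ, hσe⟩ := exists_mem_compatGroup_inversion V W
    obtain ⟨g, hg, hge⟩ := exists_mem_compatGroup_translation V W x
    obtain ⟨c, hc⟩ : ∃ c : K, g.1 (σ.1 (some c)) = b := by
      cases b with
      | none => exact ⟨0, by rw [hσe, invPerm_zero, hge]; rfl⟩
      | some y =>
        have hyx : y - x ≠ 0 := sub_ne_zero.2 fun h => hab (by rw [h])
        exact ⟨(y - x)⁻¹, by rw [hσe, invPerm_of_ne (inv_ne_zero hyx), hge]; simp⟩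
    obtain ⟨h, hh, hhe⟩ := exists_mem_compatGroup_translation V W c
    refine ⟨g * (σ * h), mul_mem hg (mul_mem hσ hh), ?_, ?_⟩
    · simp [hhe, hσe, hge, invPerm_none]
    · simpa [hhe] using hc

theorem exists_mem_compatGroup (V W : DiscVal K) {a b a' b' : Option K} (hab : a ≠ b)
    (hab' : a' ≠ b') : ∃ g ∈ compatGroup V W, g.1 a = a' ∧ g.1 b = b' := by
  obtain ⟨g, hg, hga, hgb⟩ := exists_mem_compatGroup_base V W hab
  obtain ⟨h, hh, hha, hhb⟩ := exists_mem_compatGroup_base V W hab'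
  refine ⟨h * g⁻¹, mul_mem hh (inv_mem hg), ?_, ?_⟩
  · rw [← hga, ← hha]; simp
  · rw [← hgb, ← hhb]; simp

variable (K) in
/-- The trivial valuation, whose tree is a star. -/
def trivialVal : DiscVal K where
  v _ := 0
  v_mul _ _ _ _ := by simp
  min_le _ _ _ _ _ := by simp
  complete x hx := by
    refine ⟨x 1, fun n => ?_⟩
    rcases Nat.lt_or_ge n 2 with h | h
    · right; omega
    · left
      induction n, (show 1 ≤ n by omega) using Nat.le_induction with
      | base => rfl
      | succ n hn ih =>
        rcases hx n with h' | h'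
        · rw [← h']
          rcases Nat.lt_or_ge n 2 with h2 | h2
          · obtain rfl : n = 1 := by omega
            rfl
          · exact ih h2
        · omega

/-- The `p`-adic valuation. -/
noncomputable def padicVal (p : ℕ) [Fact p.Prime] : DiscVal ℚ_[p] where
  v := Padic.valuation
  v_mul _ _ hx hy := Padic.valuation_mul hx hy
  min_le _ _ _ _ h := Padic.le_valuation_add h
  complete x hx := by
    have hp : (1 : ℝ) < p := by exact_mod_cast (Fact.out : p.Prime).one_lt
    have hp2 : (2 : ℝ) ≤ p := by exact_mod_cast (Fact.out : p.Prime).two_le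
    have hp0 : (0 : ℝ) < p := by linarith
    have hr : ((p : ℝ)⁻¹) < 1 := inv_lt_one_of_one_lt₀ hp
    have hstep : ∀ n, dist (x n) (x (n + 1)) ≤ 1 * ((p : ℝ)⁻¹) ^ n := fun n => by
      by_cases h : x n = x (n + 1)
      · rw [h, dist_self]; positivity
      · rw [dist_eq_norm, Padic.norm_eq_zpow_neg_valuation (sub_ne_zero.2 h), one_mul, inv_pow,
          ← zpow_natCast, ← zpow_neg]
        exact zpow_le_zpow_right₀ hp.le (neg_le_neg ((hx n).resolve_left h))
    obtain ⟨y, hy⟩ := cauchySeq_tendsto_of_complete (cauchySeq_of_le_geometric _ _ hr hstep)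
    refine ⟨y, fun n => ?_⟩
    by_cases h : x n = y
    · exact Or.inl h
    right
    have hd := dist_le_of_le_geometric_of_tendsto _ _ hr hstep hy n
    rw [dist_eq_norm, Padic.norm_eq_zpow_neg_valuation (sub_ne_zero.2 h), one_mul] at hd
    have hb : ((p : ℝ)⁻¹) ^ n / (1 - (p : ℝ)⁻¹) ≤ (p : ℝ) ^ (-(n : ℤ) + 1) := by
      rw [zpow_add₀ hp0.ne', zpow_neg, zpow_natCast, inv_pow, zpow_one, div_eq_mul_inv]
      refine mul_le_mul_of_nonneg_left ?_ (by positivity)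
      refine inv_le_of_inv_le₀ hp0 ?_
      have : (p : ℝ)⁻¹ ≤ 2⁻¹ := inv_anti₀ two_pos hp2
      linarith
    have := (zpow_le_zpow_iff_right₀ hp).1 (hd.trans hb)
    linarith

theorem exists_pt_of_induces {V W : DiscVal K} {φ : Tree V → Tree W}
    (hφ : ∀ o, ∀ R ∈ V.endOf o, φ '' R ∈ W.endOf o) (M : ℝ) (x : K) :
    ∃ t s : ℝ, 0 ≤ t ∧ M ≤ s ∧ φ (V.pt x t) = W.pt x s := by
  obtain ⟨-, S, hS⟩ := hφ (some x) _ (line_mem_endOf (some x))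
  obtain ⟨_, ⟨t, ht, rfl⟩, h⟩ := hS (max S M) (le_max_left _ _)
  exact ⟨t, _, ht, le_max_right _ _, h⟩

theorem not_homothety_of_induces {lam : ℝ} {φ : Tree (trivialVal ℚ_[2]) → Tree (padicVal 2)}
    (hφ : ∀ x y, dist (φ x) (φ y) = lam * dist x y) :
    ¬ ∀ o, ∀ R ∈ (trivialVal ℚ_[2]).endOf o, φ '' R ∈ (padicVal 2).endOf o := by
  intro hind
  have key : ∀ {x y : ℚ_[2]} {t s t' s' : ℝ}, x ≠ y → 0 ≤ t → 0 ≤ t' →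
      ((padicVal 2).v (x - y) : ℝ) ≤ s → ((padicVal 2).v (x - y) : ℝ) ≤ s' →
      φ (pt _ x t) = pt _ x s → φ (pt _ y t') = pt _ y s' →
      s + s' - 2 * (padicVal 2).v (x - y) = lam * (t + t') := by
    intro x y t s t' s' hxy ht ht' hs hs' h h'
    have hd := hφ (pt _ x t) (pt _ y t')
    rw [h, h', dist_pt, dist_pt, confl_of_le (p := (x, s)) hxy hs hs',
      confl_of_le (p := (x, t)) hxy] at hd
    · simpa [trivialVal] using hd
    all_goals simpa [trivialVal]
  have v2 : (padicVal 2).v 2 = 1 := by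
    have := Padic.valuation_p (p := 2)
    exact_mod_cast this
  have vm2 : (padicVal 2).v (-2) = 1 := by rw [v_neg _ _ two_ne_zero, v2]
  have vm1 : (padicVal 2).v (-1) = 0 := by rw [v_neg _ _ one_ne_zero, v_one]
  obtain ⟨t₀, s₀, ht₀, hs₀, h₀⟩ := exists_pt_of_induces hind 1 0
  obtain ⟨t₁, s₁, ht₁, hs₁, h₁⟩ := exists_pt_of_induces hind 1 1
  obtain ⟨t₂, s₂, ht₂, hs₂, h₂⟩ := exists_pt_of_induces hind 1 2
  obtain ⟨t₃, s₃, ht₃, hs₃, h₃⟩ := exists_pt_of_induces hind 1 3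
  have e01 : (0 : ℚ_[2]) - 1 = -1 := by norm_num
  have e02 : (0 : ℚ_[2]) - 2 = -2 := by norm_num
  have e13 : (1 : ℚ_[2]) - 3 = -2 := by norm_num
  have e23 : (2 : ℚ_[2]) - 3 = -1 := by norm_num
  have k01 := key (by norm_num) ht₀ ht₁ (by rw [e01, vm1]; push_cast; linarith)
    (by rw [e01, vm1]; push_cast; linarith) h₀ h₁
  have k02 := key (by norm_num) ht₀ ht₂ (by rw [e02, vm2]; push_cast; linarith)
    (by rw [e02, vm2]; push_cast; linarith) h₀ h₂
  have k13 := key (by norm_num) ht₁ ht₃ (by rw [e13, vm2]; push_cast; linarith)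
    (by rw [e13, vm2]; push_cast; linarith) h₁ h₃
  have k23 := key (by norm_num) ht₂ ht₃ (by rw [e23, vm1]; push_cast; linarith)
    (by rw [e23, vm1]; push_cast; linarith) h₂ h₃
  rw [e01, vm1] at k01
  rw [e02, vm2] at k02
  rw [e13, vm2] at k13
  rw [e23, vm1] at k23
  push_cast at k01 k02 k13 k23
  linarith

/-- The bijection between the ends of two trees given by the projective line. -/
noncomputable def endMap (V W : DiscVal K) (e : Set (Set (Tree V))) : Set (Set (Tree W)) :=
  W.endOf (Function.invFun V.endOf e)

theorem endMap_endOf (V W : DiscVal K) (o : Option K) :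
    endMap V W (V.endOf o) = W.endOf o := by
  rw [endMap, Function.leftInverse_invFun endOf_injective]

end DiscVal

open DiscVal in
theorem exists_tree_rigidity_counterexample : Nonempty TreeRigidityCounterexample := by
  let V := trivialVal ℚ_[2]
  let W := padicVal 2
  refine ⟨{
    T1 := Tree V
    T2 := Tree W
    G := compatGroup V W
    ρ₁ := ((MonoidHom.fst _ _).comp (MonoidHom.snd _ _)).comp (compatGroup V W).subtype
    ρ₂ := ((MonoidHom.snd _ _).comp (MonoidHom.snd _ _)).comp (compatGroup V W).subtype
    leafless1 := leafless
    leafless2 := leafless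
    simp1 := isUnitSimplicialTree
    simp2 := isUnitSimplicialTree
    ends1 := atLeastThreeEnds
    ends2 := atLeastThreeEnds
    two_trans1 := ?_
    two_trans2 := ?_
    f := endMap V W
    f_map := ?_
    f_inj := ?_
    f_surj := ?_
    f_equiv := ?_
    no_extension := ?_ }⟩
  · intro a b a' b' ha hb ha' hb' hab hab'
    obtain ⟨a, rfl⟩ := isEnd_iff.1 ha
    obtain ⟨b, rfl⟩ := isEnd_iff.1 hb
    obtain ⟨a', rfl⟩ := isEnd_iff.1 ha'
    obtain ⟨b', rfl⟩ := isEnd_iff.1 hb'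
    obtain ⟨g, hg, rfl, rfl⟩ := exists_mem_compatGroup V W (ne_of_apply_ne _ hab)
      (ne_of_apply_ne _ hab')
    exact ⟨⟨g, hg⟩, hg.1 a, hg.1 b⟩
  · intro a b a' b' ha hb ha' hb' hab hab'
    obtain ⟨a, rfl⟩ := isEnd_iff.1 ha
    obtain ⟨b, rfl⟩ := isEnd_iff.1 hb
    obtain ⟨a', rfl⟩ := isEnd_iff.1 ha'
    obtain ⟨b', rfl⟩ := isEnd_iff.1 hb'
    obtain ⟨g, hg, rfl, rfl⟩ := exists_mem_compatGroup V W (ne_of_apply_ne _ hab)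
      (ne_of_apply_ne _ hab')
    exact ⟨⟨g, hg⟩, hg.2 a, hg.2 b⟩
  · intro e _
    exact isEnd_iff.2 ⟨_, rfl⟩
  · intro e₁ e₂ h₁ h₂ h
    obtain ⟨a, rfl⟩ := isEnd_iff.1 h₁
    obtain ⟨b, rfl⟩ := isEnd_iff.1 h₂
    rw [endMap_endOf, endMap_endOf] at h
    rw [endOf_injective h]
  · intro e he
    obtain ⟨a, rfl⟩ := isEnd_iff.1 he
    exact ⟨V.endOf a, isEnd_iff.2 ⟨_, rfl⟩, endMap_endOf V W a⟩
  · rintro ⟨g, hg⟩ e he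
    obtain ⟨a, rfl⟩ := isEnd_iff.1 he
    have h₁ := hg.1 a
    have h₂ := hg.2 a
    rw [endMap_endOf]
    exact (congrArg (endMap V W) h₁).trans ((endMap_endOf V W _).trans h₂.symm)
  · intro lam _ φ _ hφ hind
    refine not_homothety_of_induces hφ fun o R hR => ?_
    have := hind _ (isEnd_iff.2 ⟨o, rfl⟩) R hR
    rwa [endMap_endOf] at this
end

section
/- Let X be a metric space, I a totally ordered set, and (T_i)_{i∈I} a family of subsets of X such that T_i ⊆ T_j whenever i ≤ j, the union of all T_i equals X, and each T_i equipped with the metric induced from X is an ℝ-tree. Then X is an ℝ-tree. -/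
namespace IsGeodesicSegmentBetween

variable {X Y : Type*} [MetricSpace X] [MetricSpace Y]

theorem dist_add_dist {s : Set X} {x y p : X} (hs : IsGeodesicSegmentBetween s x y)
    (hp : p ∈ s) : dist x p + dist p y = dist x y := by
  obtain ⟨γ, b, hb, hγ, rfl, rfl, rfl⟩ := hs
  obtain ⟨u, hu, rfl⟩ := hp
  have h0 : (0 : ℝ) ∈ Set.Icc 0 b := ⟨le_rfl, hb⟩
  have h1 : b ∈ Set.Icc 0 b := ⟨hb, le_rfl⟩
  rw [hγ 0 h0 u hu, hγ u hu b h1, hγ 0 h0 b h1, abs_of_nonpos (by linarith [hu.1]),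
    abs_of_nonpos (by linarith [hu.2]), abs_of_nonpos (by linarith)]
  ring

theorem image {s : Set X} {x y : X} (hs : IsGeodesicSegmentBetween s x y) {f : X → Y}
    (hf : Isometry f) : IsGeodesicSegmentBetween (f '' s) (f x) (f y) := by
  obtain ⟨γ, b, hb, hγ, rfl, rfl, rfl⟩ := hs
  refine ⟨f ∘ γ, b, hb, fun u hu v hv => ?_, rfl, rfl, (Set.image_comp f γ _).symm⟩
  simpa [hf.dist_eq] using hγ u hu v hv

/-- A geodesic segment contained in another one with the same endpoints is equal to it. -/
theorem eq_of_subset {s t : Set X} {x y : X} (hs : IsGeodesicSegmentBetween s x y)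
    (ht : IsGeodesicSegmentBetween t x y) (hst : s ⊆ t) : s = t := by
  obtain ⟨γ, b, hb, hγ, hγ0, hγb, rfl⟩ := hs
  obtain ⟨δ, c, hc, hδ, hδ0, hδc, rfl⟩ := ht
  have hbc : b = c := by
    have h₁ := hγ 0 ⟨le_rfl, hb⟩ b ⟨hb, le_rfl⟩
    have h₂ := hδ 0 ⟨le_rfl, hc⟩ c ⟨hc, le_rfl⟩
    rw [hγ0, hγb, zero_sub, abs_neg, abs_of_nonneg hb] at h₁
    rw [hδ0, hδc, zero_sub, abs_neg, abs_of_nonneg hc] at h₂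
    linarith
  subst hbc
  refine hst.antisymm ?_
  rintro _ ⟨u, hu, rfl⟩
  obtain ⟨v, hv, hvu⟩ := hst ⟨u, hu, rfl⟩
  have h₁ := hγ 0 ⟨le_rfl, hb⟩ u hu
  have h₂ := hδ 0 ⟨le_rfl, hb⟩ v hv
  rw [hγ0, zero_sub, abs_neg, abs_of_nonneg hu.1] at h₁
  rw [hδ0, hvu, zero_sub, abs_neg, abs_of_nonneg hv.1] at h₂
  have huv : u = v := by linarith
  exact ⟨u, hu, by rw [← hvu, huv]⟩

/-- Geodesic segments from `x` to `p` and from `p` to `y` can be concatenated when `p` lies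
metrically between `x` and `y`. -/
theorem union {s t : Set X} {x p y : X} (hs : IsGeodesicSegmentBetween s x p)
    (ht : IsGeodesicSegmentBetween t p y) (hp : dist x p + dist p y = dist x y) :
    IsGeodesicSegmentBetween (s ∪ t) x y := by
  obtain ⟨γ, b, hb, hγ, hγ0, hγb, rfl⟩ := hs
  obtain ⟨δ, c, hc, hδ, hδ0, hδc, rfl⟩ := ht
  have hxp := hγ 0 ⟨le_rfl, hb⟩ b ⟨hb, le_rfl⟩
  have hpy := hδ 0 ⟨le_rfl, hc⟩ c ⟨hc, le_rfl⟩
  rw [hγ0, hγb, zero_sub, abs_neg, abs_of_nonneg hb] at hxp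
  rw [hδ0, hδc, zero_sub, abs_neg, abs_of_nonneg hc] at hpy
  have cross : ∀ u ∈ Set.Icc 0 b, ∀ v ∈ Set.Icc 0 c, dist (γ u) (δ v) = b - u + v := by
    intro u hu v hv
    have h₁ := hγ 0 ⟨le_rfl, hb⟩ u hu
    have h₂ := hγ u hu b ⟨hb, le_rfl⟩
    have h₃ := hδ 0 ⟨le_rfl, hc⟩ v hv
    have h₄ := hδ v hv c ⟨hc, le_rfl⟩
    rw [hγ0, zero_sub, abs_neg, abs_of_nonneg hu.1] at h₁
    rw [hγb, abs_of_nonpos (by linarith [hu.2])] at h₂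
    rw [hδ0, zero_sub, abs_neg, abs_of_nonneg hv.1] at h₃
    rw [hδc, abs_of_nonpos (by linarith [hv.2])] at h₄
    have h₅ := dist_triangle (γ u) p (δ v)
    have h₆ := dist_triangle4 x (γ u) (δ v) y
    linarith
  have left : ∀ u ≤ b, (if u ≤ b then γ u else δ (u - b)) = γ u := fun u hu => if_pos hu
  have right : ∀ u, b ≤ u → (if u ≤ b then γ u else δ (u - b)) = δ (u - b) := by
    intro u hu
    split_ifs with h
    · obtain rfl := le_antisymm h hu
      rw [sub_self, hδ0, hγb]
    · rfl
  refine ⟨fun u => if u ≤ b then γ u else δ (u - b), b + c, by linarith, ?_, ?_, ?_, ?_⟩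
  · intro u hu v hv
    dsimp only
    rcases le_total u b with h | h <;> rcases le_total v b with h' | h'
    · rw [left u h, left v h', hγ u ⟨hu.1, h⟩ v ⟨hv.1, h'⟩]
    · rw [left u h, right v h', cross u ⟨hu.1, h⟩ (v - b) ⟨by linarith, by linarith [hv.2]⟩,
        abs_of_nonpos (by linarith)]
      ring
    · rw [right u h, left v h', dist_comm,
        cross v ⟨hv.1, h'⟩ (u - b) ⟨by linarith, by linarith [hu.2]⟩,
        abs_of_nonneg (by linarith)]
      ring
    · rw [right u h, right v h', hδ (u - b) ⟨by linarith, by linarith [hu.2]⟩ (v - b)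
        ⟨by linarith, by linarith [hv.2]⟩, sub_sub_sub_cancel_right]
  · exact (left 0 hb).trans hγ0
  · refine (right (b + c) (by linarith)).trans ?_
    rw [add_sub_cancel_left, hδc]
  · ext q
    constructor
    · rintro (⟨u, hu, rfl⟩ | ⟨u, hu, rfl⟩)
      · exact ⟨u, ⟨hu.1, by linarith [hu.2]⟩, left u hu.2⟩
      · refine ⟨b + u, ⟨by linarith [hu.1], by linarith [hu.2]⟩, ?_⟩
        refine (right (b + u) (by linarith [hu.1])).trans ?_
        rw [add_sub_cancel_left]
    · rintro ⟨u, hu, rfl⟩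
      rcases le_total u b with h | h
      · exact Or.inl ⟨u, ⟨hu.1, h⟩, (left u h).symm⟩
      · exact Or.inr ⟨u - b, ⟨by linarith, by linarith [hu.2]⟩, (right u h).symm⟩

theorem right_mem {s : Set X} {x y : X} (hs : IsGeodesicSegmentBetween s x y) : y ∈ s := by
  obtain ⟨γ, b, hb, -, -, rfl, rfl⟩ := hs
  exact ⟨b, ⟨hb, le_rfl⟩, rfl⟩

end IsGeodesicSegmentBetween

/-- In an ℝ-tree, the geodesic segment from `x` to `y` contains every point lying metrically
between `x` and `y`. -/
theorem IsRTree.mem_of_dist_add_dist {X : Type*} [MetricSpace X] (hX : IsRTree X) {s : Set X}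
    {x y p : X} (hs : IsGeodesicSegmentBetween s x y) (hp : dist x p + dist p y = dist x y) :
    p ∈ s := by
  obtain ⟨s₁, hs₁, -⟩ := hX.1 x p
  obtain ⟨s₂, hs₂, -⟩ := hX.1 p y
  rw [(hX.1 x y).unique hs (hs₁.union hs₂ hp)]
  exact Or.inl hs₁.right_mem

theorem rtree_of_directed_union_of_subtrees {X : Type*} [MetricSpace X]
    {I : Type*} [LinearOrder I] (T : I → Set X)
    (hmono : ∀ i j : I, i ≤ j → T i ⊆ T j)
    (hunion : (⋃ i : I, T i) = Set.univ)
    (htree : ∀ i : I, IsRTree (T i)) :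
    IsRTree X := by
  have hmem : ∀ x : X, ∃ i, x ∈ T i := fun x => Set.mem_iUnion.1 (hunion ▸ Set.mem_univ x)
  have huniq : ∀ (i : I) (x y : T i) (s : Set (T i)) (t : Set X),
      IsGeodesicSegmentBetween s x y → IsGeodesicSegmentBetween t (x : X) (y : X) →
        t = Subtype.val '' s := by
    intro i x y s t hs ht
    refine ht.eq_of_subset (hs.image isometry_subtype_coe) fun p hp => ?_
    obtain ⟨k, hk⟩ := hmem p
    have hij : T i ⊆ T (max i k) := hmono _ _ (le_max_left i k)
    have hseg := hs.image (f := Set.inclusion hij) (Isometry.of_dist_eq fun _ _ => rfl)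
    obtain ⟨q, hq, hqp⟩ := (htree (max i k)).mem_of_dist_add_dist
      (p := ⟨p, hmono _ _ (le_max_right i k) hk⟩) hseg (ht.dist_add_dist hp)
    exact ⟨q, hq, congrArg Subtype.val hqp⟩
  refine ⟨fun x y => ?_, fun s t x y z hs ht hst => ?_⟩
  · obtain ⟨i, hx⟩ := hmem x
    obtain ⟨j, hy⟩ := hmem y
    obtain ⟨s, hs, -⟩ := (htree (max i j)).1 ⟨x, hmono _ _ (le_max_left i j) hx⟩
      ⟨y, hmono _ _ (le_max_right i j) hy⟩
    exact ⟨_, hs.image isometry_subtype_coe, fun t ht => huniq _ _ _ _ _ hs ht⟩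
  · obtain ⟨i, hx⟩ := hmem x
    obtain ⟨j, hy⟩ := hmem y
    obtain ⟨k, hz⟩ := hmem z
    obtain ⟨m, him, hjm, hkm⟩ : ∃ m, i ≤ m ∧ j ≤ m ∧ k ≤ m :=
      ⟨max i (max j k), by simp, by simp, by simp⟩
    let x' : T m := ⟨x, hmono _ _ him hx⟩
    let y' : T m := ⟨y, hmono _ _ hjm hy⟩
    let z' : T m := ⟨z, hmono _ _ hkm hz⟩
    obtain ⟨s', hs', -⟩ := (htree m).1 x' y'
    obtain ⟨t', ht', -⟩ := (htree m).1 y' z'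
    obtain rfl := huniq m x' y' s' s hs' hs
    obtain rfl := huniq m y' z' t' t ht' ht
    rw [← Set.image_union]
    refine ((htree m).2 s' t' x' y' z' hs' ht' ?_).image isometry_subtype_coe
    apply Subtype.val_injective.image_injective
    rw [Set.image_inter Subtype.val_injective, hst, Set.image_singleton]
end
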